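/- In the monoid M_Bii, if b·X = c·Y for elements X, Y of M_Bii, then there exist a natural number k and an element Z of M_Bii such that X = c^k·b·a·Z and Y = a^k·b·b·Z. -/

import Mathlib

/-- The three generators of the monoid `M_Bii`. -/
inductive BiiGen : Type
  | a | b | c

open FreeMonoid in
/-- The positive homogeneous relations `cbb = bba`, `bc = ab`, `ac = ca`. -/
def biiRel : FreeMonoid BiiGen → FreeMonoid BiiGen → Prop := fun x y =>
  (x = of .c * of .b * of .b ∧ y = of .b * of .b * of .a) ∨
  (x = of .b * of .c ∧ y = of .a * of .b) ∨
  (x = of .a * of .c ∧ y = of .c * of .a)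

/-- The monoid `M_Bii`: quotient of the free monoid on `{a,b,c}` by the congruence
generated by the relations `cbb = bba`, `bc = ab`, `ac = ca`. -/
abbrev MBii : Type := (conGen biiRel).Quotient

/-- The image of the generator `a` in `M_Bii`. -/
def MBii.a : MBii := (conGen biiRel).mk' (FreeMonoid.of BiiGen.a)
/-- The image of the generator `b` in `M_Bii`. -/
def MBii.b : MBii := (conGen biiRel).mk' (FreeMonoid.of BiiGen.b)
/-- The image of the generator `c` in `M_Bii`. -/
def MBii.c : MBii := (conGen biiRel).mk' (FreeMonoid.of BiiGen.c)

namespace MBii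

theorem c_mul_b_mul_b : c * b * b = b * b * a :=
  (Con.eq _).2 (ConGen.Rel.of _ _ (Or.inl ⟨rfl, rfl⟩))

theorem b_mul_c : b * c = a * b :=
  (Con.eq _).2 (ConGen.Rel.of _ _ (Or.inr (Or.inl ⟨rfl, rfl⟩)))

theorem a_mul_c : a * c = c * a :=
  (Con.eq _).2 (ConGen.Rel.of _ _ (Or.inr (Or.inr ⟨rfl, rfl⟩)))

theorem commute_a_c : Commute a c := a_mul_c

theorem b_mul_c_pow (n : ℕ) : b * c ^ n = a ^ n * b :=
  SemiconjBy.pow_right (show SemiconjBy b c a from b_mul_c) n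

theorem b_mul_a_pow_mul_b_mul_a (i : ℕ) : b * a ^ i * b * a = c * (b * a ^ i * b) := by
  calc b * a ^ i * b * a = b * (a ^ i * b) * a := by simp only [mul_assoc]
    _ = b * b * (c ^ i * a) := by rw [← b_mul_c_pow]; simp only [mul_assoc]
    _ = b * b * a * c ^ i := by rw [← (commute_a_c.pow_right i).eq]; simp only [mul_assoc]
    _ = c * (b * (b * c ^ i)) := by rw [← c_mul_b_mul_b]; simp only [mul_assoc]
    _ = c * (b * a ^ i * b) := by rw [b_mul_c_pow]; simp only [mul_assoc]

theorem b_mul_a_pow_mul_b_mul_a_pow (i k : ℕ) :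
    b * a ^ i * b * a ^ k = c ^ k * (b * a ^ i * b) :=
  SemiconjBy.pow_right
    (show SemiconjBy (b * a ^ i * b) a c from b_mul_a_pow_mul_b_mul_a i) k

/-- Induction principle: a predicate stable under left multiplication by the generators. -/
theorem induction_left {P : MBii → Prop} (one : P 1) (ha : ∀ w, P w → P (a * w))
    (hb : ∀ w, P w → P (b * w)) (hc : ∀ w, P w → P (c * w)) (w : MBii) : P w := by
  obtain ⟨w, rfl⟩ := Con.mk'_surjective w
  induction w using FreeMonoid.inductionOn' with
  | one => simpa using one
  | of_mul g w ih =>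
    rw [map_mul]
    cases g
    exacts [ha _ ih, hb _ ih, hc _ ih]

/-- The action of a generator on exponent vectors. The vector `(i, j, k, n)` stands for the
element `a ^ i * c ^ j * (b * a * b⁻¹) ^ k * b ^ n` of the enveloping group, in which conjugation
by `b` permutes `c`, `a`, `b * a * b⁻¹` cyclically. -/
def genAct : BiiGen → Function.End (ℕ × ℕ × ℕ × ℕ)
  | .a => fun p => (p.1 + 1, p.2.1, p.2.2.1, p.2.2.2)
  | .b => fun p => (p.2.1, p.2.2.1, p.1, p.2.2.2 + 1)
  | .c => fun p => (p.1, p.2.1 + 1, p.2.2.1, p.2.2.2)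

/-- The action of `M_Bii` on exponent vectors. -/
def act : MBii →* Function.End (ℕ × ℕ × ℕ × ℕ) :=
  (conGen biiRel).lift (FreeMonoid.lift genAct) <| Con.conGen_le.2 <| by
    rintro x y (⟨rfl, rfl⟩ | ⟨rfl, rfl⟩ | ⟨rfl, rfl⟩) <;> rfl

/-- The exponent vector of an element. -/
def exponents (w : MBii) : ℕ × ℕ × ℕ × ℕ := act w (0, 0, 0, 0)

theorem exponents_one : exponents 1 = (0, 0, 0, 0) := rfl

theorem exponents_mul (v w : MBii) : exponents (v * w) = act v (exponents w) := by
  simp only [exponents, map_mul]; rfl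

theorem exponents_a_mul (w : MBii) : exponents (a * w) = genAct .a (exponents w) :=
  exponents_mul a w

theorem exponents_b_mul (w : MBii) : exponents (b * w) = genAct .b (exponents w) :=
  exponents_mul b w

theorem exponents_c_mul (w : MBii) : exponents (c * w) = genAct .c (exponents w) :=
  exponents_mul c w

/-- The normal form with a given exponent vector (the third exponent is ignored when there is
no `b`). -/
def normalForm : ℕ × ℕ × ℕ × ℕ → MBii
  | (i, j, _, 0) => a ^ i * c ^ j
  | (i, j, k, n + 1) => a ^ i * c ^ j * b * a ^ k * b ^ n

theorem normalForm_genAct_a (p : ℕ × ℕ × ℕ × ℕ) :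
    normalForm (genAct .a p) = a * normalForm p := by
  obtain ⟨i, j, k, _ | n⟩ := p <;> simp only [genAct, normalForm, pow_succ', mul_assoc]

theorem normalForm_genAct_c (p : ℕ × ℕ × ℕ × ℕ) :
    normalForm (genAct .c p) = c * normalForm p := by
  obtain ⟨i, j, k, _ | n⟩ := p <;>
    simp only [genAct, normalForm, pow_succ', ← mul_assoc, (commute_a_c.pow_left i).eq]

theorem b_mul_a_pow_mul_c_pow (i j : ℕ) : b * (a ^ i * c ^ j) = a ^ j * (b * a ^ i) := by
  rw [(commute_a_c.pow_pow i j).eq, ← mul_assoc, b_mul_c_pow, mul_assoc]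

theorem normalForm_genAct_b (p : ℕ × ℕ × ℕ × ℕ) (hp : p.2.2.2 = 0 → p.2.2.1 = 0) :
    normalForm (genAct .b p) = b * normalForm p := by
  obtain ⟨i, j, k, _ | n⟩ := p
  · obtain rfl : k = 0 := hp rfl
    simp only [genAct, normalForm, b_mul_a_pow_mul_c_pow, pow_zero, mul_one, mul_assoc]
  · calc a ^ j * c ^ k * b * a ^ i * b ^ (n + 1)
        = a ^ j * (c ^ k * (b * a ^ i * b)) * b ^ n := by simp only [pow_succ', mul_assoc]
      _ = a ^ j * (b * a ^ i) * b * a ^ k * b ^ n := by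
        rw [← b_mul_a_pow_mul_b_mul_a_pow]; simp only [mul_assoc]
      _ = b * (a ^ i * c ^ j * b * a ^ k * b ^ n) := by
        rw [← b_mul_a_pow_mul_c_pow]; simp only [mul_assoc]

theorem exponents_third_eq_zero (w : MBii) :
    (exponents w).2.2.2 = 0 → (exponents w).2.2.1 = 0 := by
  induction w using induction_left with
  | one => exact fun _ => rfl
  | ha w ih => rwa [exponents_a_mul]
  | hb w ih => rw [exponents_b_mul]; exact fun h => absurd h (Nat.succ_ne_zero _)
  | hc w ih => rwa [exponents_c_mul]

theorem normalForm_exponents (w : MBii) : normalForm (exponents w) = w := by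
  induction w using induction_left with
  | one => simp [exponents_one, normalForm]
  | ha w ih => rw [exponents_a_mul, normalForm_genAct_a, ih]
  | hb w ih =>
    rw [exponents_b_mul, normalForm_genAct_b _ (exponents_third_eq_zero w), ih]
  | hc w ih => rw [exponents_c_mul, normalForm_genAct_c, ih]

theorem exponents_injective : Function.Injective exponents :=
  Function.LeftInverse.injective normalForm_exponents

theorem c_mul_left_cancel {v w : MBii} (h : c * v = c * w) : v = w := by
  apply exponents_injective
  have h' := congrArg exponents h
  rw [exponents_c_mul, exponents_c_mul] at h'
  simpa [genAct, Prod.ext_iff] using h'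

theorem b_mul_c_pow_mul_b_mul_a (k : ℕ) : b * (c ^ k * b * a) = c * (a ^ k * b * b) := by
  calc b * (c ^ k * b * a) = b * c ^ k * b * a := by simp only [mul_assoc]
    _ = a ^ k * (b * b * a) := by rw [b_mul_c_pow]; simp only [mul_assoc]
    _ = a ^ k * c * b * b := by rw [← c_mul_b_mul_b]; simp only [mul_assoc]
    _ = c * (a ^ k * b * b) := by rw [(commute_a_c.pow_left k).eq]; simp only [mul_assoc]

theorem exists_eq_of_exponents_third_pos (X : MBii) (h : 0 < (exponents X).2.2.1) :
    ∃ (k : ℕ) (Z : MBii), X = c ^ k * b * a * Z := by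
  have hX := normalForm_exponents X
  have hn := exponents_third_eq_zero X
  generalize exponents X = p at h hX hn
  obtain ⟨i, j, k, n⟩ := p
  obtain ⟨l, rfl⟩ : ∃ l, k = l + 1 := Nat.exists_eq_succ_of_ne_zero h.ne'
  obtain _ | n := n
  · exact absurd (hn rfl) (Nat.succ_ne_zero l)
  refine ⟨j, c ^ i * a ^ l * b ^ n, ?_⟩
  calc X = a ^ i * c ^ j * b * a ^ (l + 1) * b ^ n := hX.symm
    _ = c ^ j * (a ^ i * b) * a * a ^ l * b ^ n := by
      rw [(commute_a_c.pow_pow i j).eq, pow_succ']; simp only [mul_assoc]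
    _ = c ^ j * b * (c ^ i * a) * a ^ l * b ^ n := by
      rw [← b_mul_c_pow]; simp only [mul_assoc]
    _ = c ^ j * b * a * (c ^ i * a ^ l * b ^ n) := by
      rw [← (commute_a_c.pow_right i).eq]; simp only [mul_assoc]

end MBii

theorem MBii_bX_eq_cY (X Y : MBii) (h : MBii.b * X = MBii.c * Y) :
    ∃ (k : ℕ) (Z : MBii),
      X = MBii.c ^ k * MBii.b * MBii.a * Z ∧ Y = MBii.a ^ k * MBii.b * MBii.b * Z := by
  have hpos : 0 < (MBii.exponents X).2.2.1 := by
    have h' := congrArg (fun w => (MBii.exponents w).2.1) h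
    simp only [MBii.exponents_b_mul, MBii.exponents_c_mul, MBii.genAct] at h'
    omega
  obtain ⟨k, Z, rfl⟩ := MBii.exists_eq_of_exponents_third_pos X hpos
  refine ⟨k, Z, rfl, MBii.c_mul_left_cancel ?_⟩
  rw [← h, ← mul_assoc, MBii.b_mul_c_pow_mul_b_mul_a, mul_assoc]
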